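/- For every real number α with 1 < α < 2 there exist constants c > 0 and d₀ such that for all integers d ≥ d₀, |F^E_5| ≥ (e − 2√e + 1 − e^{−cd})·2^{2^{d−1}}. -/

import Mathlib

/-- Two vertices of the Hamming cube `{0,1}^d` are adjacent iff they differ in
exactly one coordinate. -/
def cubeAdj (d : ℕ) (u v : Fin d → Bool) : Prop :=
  (Finset.univ.filter fun i => u i ≠ v i).card = 1


/-- The even vertices of the Hamming cube. -/
def evenV (d : ℕ) : Set (Fin d → Bool) :=
  {v | Even (Finset.univ.filter fun i => v i = true).card}

/-- The odd vertices of the Hamming cube. -/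
def oddV (d : ℕ) : Set (Fin d → Bool) :=
  {v | ¬ Even (Finset.univ.filter fun i => v i = true).card}


/-- Homomorphisms from \`Q_d\` to \`ℤ\` taking the value \`0\` on all but fewer than
\`α^d\` even vertices. -/
def FE (d : ℕ) (α : ℝ) : Set ((Fin d → Bool) → ℤ) :=
  {f | (∀ u v, cubeAdj d u v → |f u - f v| = 1) ∧
       (({v ∈ evenV d | f v ≠ 0} : Set _).ncard : ℝ) < α ^ d}

/-- Members of \`FE d α\` whose range has exactly \`i\` elements. -/
def FEi (d : ℕ) (α : ℝ) (i : ℕ) : Set ((Fin d → Bool) → ℤ) :=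
  {f ∈ FE d α | (Set.range f).ncard = i}

namespace HammingCube

/-- The vertex obtained from `v` by changing coordinate `i`. -/
def flip {d : ℕ} (v : Fin d → Bool) (i : Fin d) : Fin d → Bool :=
  Function.update v i (!v i)

/-- The even vertices of the Hamming cube, as a finset. -/
def evens (d : ℕ) : Finset (Fin d → Bool) :=
  Finset.univ.filter fun v => Even (Finset.univ.filter fun i => v i = true).card

/-- The set of vertices adjacent to some vertex of `A`. -/
def nbhd {d : ℕ} (A : Finset (Fin d → Bool)) : Finset (Fin d → Bool) :=
  A.biUnion fun v => Finset.univ.image (flip v)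

variable {d : ℕ}

theorem flip_apply_self (v : Fin d → Bool) (i : Fin d) : flip v i i = !v i :=
  Function.update_self ..

theorem flip_apply_of_ne (v : Fin d → Bool) {i j : Fin d} (h : j ≠ i) : flip v i j = v j :=
  Function.update_of_ne h ..

theorem flip_flip (v : Fin d → Bool) (i : Fin d) : flip (flip v i) i = v := by
  funext j
  by_cases h : j = i
  · subst h; simp [flip]
  · simp [flip, h]

theorem cubeAdj_iff_flip {u v : Fin d → Bool} : cubeAdj d u v ↔ ∃ i, flip u i = v := by
  constructor
  · intro h
    obtain ⟨i, hi⟩ := Finset.card_eq_one.1 h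
    refine ⟨i, funext fun j => ?_⟩
    have hj : u j ≠ v j ↔ j = i := by simpa using Finset.ext_iff.1 hi j
    by_cases h : j = i
    · subst h
      have := hj.2 rfl
      cases hu : u j <;> cases hv : v j <;> simp_all [flip]
    · have : u j = v j := by
        by_contra h'
        exact h (hj.1 h')
      simp [flip, h, this]
  · rintro ⟨i, rfl⟩
    refine Finset.card_eq_one.2 ⟨i, Finset.ext fun j => ?_⟩
    by_cases h : j = i
    · subst h; simp [flip_apply_self]
    · simp [flip_apply_of_ne u h, h]

theorem flip_mem_evens (v : Fin d → Bool) (i : Fin d) : flip v i ∈ evens d ↔ v ∉ evens d := by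
  have key : ∀ w : Fin d → Bool, w i = false →
      (Finset.univ.filter fun j => flip w i j = true).card =
        (Finset.univ.filter fun j => w j = true).card + 1 := by
    intro w hw
    rw [← Finset.card_insert_of_notMem (a := i) (by simp [hw])]
    congr 1
    ext j
    by_cases h : j = i
    · subst h; simp [flip_apply_self, hw]
    · simp [flip_apply_of_ne w h, h]
  cases hv : v i
  · simp only [evens, Finset.mem_filter, Finset.mem_univ, true_and, key v hv, Nat.even_add_one]
  · have hw : flip v i i = false := by simp [flip, hv]
    have := key (flip v i) hw
    rw [flip_flip] at this
    simp only [evens, Finset.mem_filter, Finset.mem_univ, true_and, this, Nat.even_add_one, not_not]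

theorem mem_nbhd {A : Finset (Fin d → Bool)} {w : Fin d → Bool} :
    w ∈ nbhd A ↔ ∃ v ∈ A, ∃ i, flip v i = w := by
  simp [nbhd]

theorem card_nbhd_le (A : Finset (Fin d → Bool)) : (nbhd A).card ≤ d * A.card := by
  rw [mul_comm]
  refine Finset.card_biUnion_le_card_mul _ _ _ fun v _ => ?_
  simpa using Finset.card_image_le (s := Finset.univ) (f := flip v)

theorem nbhd_subset_compl_evens {A : Finset (Fin d → Bool)} (hA : A ⊆ evens d) :
    nbhd A ⊆ (evens d)ᶜ := by
  intro w hw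
  obtain ⟨v, hv, i, rfl⟩ := mem_nbhd.1 hw
  rw [Finset.mem_compl, flip_mem_evens, not_not]
  exact hA hv

theorem card_evens_eq_card_compl (hd : 1 ≤ d) : (evens d).card = ((evens d)ᶜ).card := by
  let i : Fin d := ⟨0, hd⟩
  refine Finset.card_bij' (fun v _ => flip v i) (fun v _ => flip v i) ?_ ?_ ?_ ?_
  · intro v hv
    simpa [flip_mem_evens] using hv
  · intro v hv
    simpa [flip_mem_evens] using hv
  · intro v _; exact flip_flip v i
  · intro v _; exact flip_flip v i

theorem card_evens (hd : 1 ≤ d) : (evens d).card = 2 ^ (d - 1) := by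
  have h1 := card_evens_eq_card_compl hd
  have h2 := Finset.card_add_card_compl (evens d)
  have h3 : Fintype.card (Fin d → Bool) = 2 ^ d := by simp
  obtain ⟨k, rfl⟩ := Nat.exists_eq_add_of_le' hd
  rw [h3, pow_succ] at h2
  simp only [Nat.add_sub_cancel]
  omega

theorem disjoint_nbhd {A B : Finset (Fin d → Bool)} (h : Disjoint B (nbhd (nbhd A))) :
    Disjoint (nbhd A) (nbhd B) := by
  rw [Finset.disjoint_left]
  intro w hA hB
  obtain ⟨v, hv, i, rfl⟩ := mem_nbhd.1 hB
  exact Finset.disjoint_left.1 h hv (mem_nbhd.2 ⟨_, hA, i, flip_flip v i⟩)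

theorem subset_nbhd_nbhd (hd : 1 ≤ d) (A : Finset (Fin d → Bool)) : A ⊆ nbhd (nbhd A) := by
  intro v hv
  exact mem_nbhd.2 ⟨_, mem_nbhd.2 ⟨v, hv, ⟨0, hd⟩, rfl⟩, ⟨0, hd⟩, flip_flip v _⟩

/-- The function which is `2` on `A`, `-2` on `B`, `0` on the other even vertices, `1` on `T` and
`-1` elsewhere. -/
def labelling (A B T : Finset (Fin d → Bool)) (v : Fin d → Bool) : ℤ :=
  if v ∈ A then 2 else if v ∈ B then -2 else if v ∈ evens d then 0 else if v ∈ T then 1 else -1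

section labelling

variable {A B T : Finset (Fin d → Bool)}

theorem labelling_eq_two {v : Fin d → Bool} : labelling A B T v = 2 ↔ v ∈ A := by
  unfold labelling; split_ifs <;> simp_all

theorem labelling_eq_neg_two (h : Disjoint A B) {v : Fin d → Bool} :
    labelling A B T v = -2 ↔ v ∈ B := by
  have : v ∈ A → v ∉ B := fun h' => Finset.disjoint_left.1 h h'
  unfold labelling; split_ifs <;> simp_all

theorem labelling_eq_one (hA : A ⊆ evens d) (hB : B ⊆ evens d) (hT : T ⊆ (evens d)ᶜ)
    {v : Fin d → Bool} : labelling A B T v = 1 ↔ v ∈ T := by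
  have h1 : v ∈ A → v ∈ evens d := fun h => hA h
  have h2 : v ∈ B → v ∈ evens d := fun h => hB h
  have h3 : v ∈ T → v ∉ evens d := fun h => Finset.mem_compl.1 (hT h)
  unfold labelling; split_ifs <;> simp_all

theorem abs_labelling_flip (hA : A ⊆ evens d) (hB : B ⊆ evens d)
    (hAT : nbhd A ⊆ T) (hBT : Disjoint (nbhd B) T) {v : Fin d → Bool} (hv : v ∈ evens d)
    (i : Fin d) : |labelling A B T v - labelling A B T (flip v i)| = 1 := by
  have h0 : flip v i ∉ evens d := by rw [flip_mem_evens, not_not]; exact hv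
  have h1 : flip v i ∉ A := fun h => h0 (hA h)
  have h2 : flip v i ∉ B := fun h => h0 (hB h)
  have h3 : v ∈ A → flip v i ∈ T := fun h => hAT (mem_nbhd.2 ⟨v, h, i, rfl⟩)
  have h4 : v ∈ B → flip v i ∉ T := fun h =>
    Finset.disjoint_left.1 hBT (mem_nbhd.2 ⟨v, h, i, rfl⟩)
  unfold labelling
  split_ifs <;> simp_all

theorem labelling_mem_FEi {α : ℝ} (hd : 1 ≤ d) (hα : (2 * d : ℝ) < α ^ d)
    (hα' : α ^ d < 2 ^ (d - 1)) (hA : A ⊆ evens d) (hB : B ⊆ evens d)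
    (hA0 : A.Nonempty) (hB0 : B.Nonempty) (hAd : A.card ≤ d) (hBd : B.card ≤ d)
    (hAB : Disjoint A B) (hT : T ⊆ (evens d)ᶜ)
    (hAT : nbhd A ⊆ T) (hBT : Disjoint (nbhd B) T) : labelling A B T ∈ FEi d α 5 := by
  have hcard : (A ∪ B).card ≤ 2 * d := (Finset.card_union_le _ _).trans (by omega)
  refine ⟨⟨fun u v huv => ?_, ?_⟩, ?_⟩
  · obtain ⟨i, rfl⟩ := cubeAdj_iff_flip.1 huv
    by_cases hu : u ∈ evens d
    · exact abs_labelling_flip hA hB hAT hBT hu i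
    · have := abs_labelling_flip hA hB hAT hBT ((flip_mem_evens u i).2 hu) i
      rwa [flip_flip, abs_sub_comm] at this
  · refine lt_of_le_of_lt ?_ hα
    have hsub : {v ∈ evenV d | labelling A B T v ≠ 0} ⊆ ((A ∪ B : Finset _) : Set _) := by
      rintro v ⟨hv, hv0⟩
      have hv' : v ∈ evens d := by simpa [evens, evenV] using hv
      by_contra h
      simp only [Finset.coe_union, Set.mem_union, Finset.mem_coe, not_or] at h
      exact hv0 (by simp [labelling, h.1, h.2, hv'])
    have := Set.ncard_le_ncard hsub (Finset.finite_toSet _)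
    rw [Set.ncard_coe_finset] at this
    exact_mod_cast this.trans hcard
  · have hrange : Set.range (labelling A B T) = (({-2, -1, 0, 1, 2} : Finset ℤ) : Set ℤ) := by
      apply Set.Subset.antisymm
      · rintro _ ⟨v, rfl⟩
        unfold labelling
        split_ifs <;> simp
      · obtain ⟨a, ha⟩ := hA0
        obtain ⟨b, hb⟩ := hB0
        have hbN : flip b ⟨0, hd⟩ ∈ nbhd B := mem_nbhd.2 ⟨b, hb, _, rfl⟩
        have hbE := Finset.mem_compl.1 (nbhd_subset_compl_evens hB hbN)
        have hbA : flip b ⟨0, hd⟩ ∉ A := fun h => hbE (hA h)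
        have hbB : flip b ⟨0, hd⟩ ∉ B := fun h => hbE (hB h)
        have hbT := Finset.disjoint_left.1 hBT hbN
        obtain ⟨z, hz, hz'⟩ : ∃ z ∈ evens d, z ∉ A ∪ B := by
          apply Finset.exists_mem_notMem_of_card_lt_card
          rw [card_evens hd]
          refine lt_of_le_of_lt hcard ?_
          exact_mod_cast hα.trans hα'
        rw [Finset.mem_union, not_or] at hz'
        intro x hx
        simp only [Finset.coe_insert, Finset.coe_singleton, Set.mem_insert_iff,
          Set.mem_singleton_iff] at hx
        rcases hx with rfl | rfl | rfl | rfl | rfl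
        · exact ⟨b, (labelling_eq_neg_two hAB).2 hb⟩
        · exact ⟨flip b ⟨0, hd⟩, by simp [labelling, hbE, hbT, hbA, hbB]⟩
        · exact ⟨z, by simp [labelling, hz, hz'.1, hz'.2]⟩
        · exact ⟨flip a ⟨0, hd⟩, (labelling_eq_one hA hB hT).2
            (hAT (mem_nbhd.2 ⟨a, ha, _, rfl⟩))⟩
        · exact ⟨a, labelling_eq_two.2 ha⟩
    rw [hrange, Set.ncard_coe_finset]
    rfl

end labelling

theorem abs_sub_le_card {f : (Fin d → Bool) → ℤ} (hf : ∀ u v, cubeAdj d u v → |f u - f v| = 1)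
    (u v : Fin d → Bool) : |f u - f v| ≤ (Finset.univ.filter fun i => u i ≠ v i).card := by
  induction h : (Finset.univ.filter fun i => u i ≠ v i).card generalizing u with
  | zero =>
    have : u = v := by
      funext i
      by_contra hi
      have := Finset.card_eq_zero.1 h
      exact Finset.notMem_empty i (this ▸ by simpa using hi)
    simp [this]
  | succ n ih =>
    obtain ⟨i, hi⟩ := Finset.card_pos.1 (by omega :
      0 < (Finset.univ.filter fun i => u i ≠ v i).card)
    have hi' : u i ≠ v i := by simpa using hi
    have hflip : (Finset.univ.filter fun j => flip u i j ≠ v j) =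
        (Finset.univ.filter fun j => u j ≠ v j).erase i := by
      ext j
      by_cases hj : j = i
      · subst hj
        cases hu : u j <;> cases hv : v j <;> simp_all [flip]
      · simp [flip_apply_of_ne u hj, hj]
    have h1 := ih (flip u i) (by rw [hflip, Finset.card_erase_of_mem hi]; omega)
    have h2 := hf u (flip u i) (cubeAdj_iff_flip.2 ⟨i, rfl⟩)
    have h3 := abs_sub_le (f u) (f (flip u i)) (f v)
    push_cast
    omega

theorem finite_FE {α : ℝ} (hd : 1 ≤ d) (hα : α ^ d < 2 ^ (d - 1)) : (FE d α).Finite := by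
  refine (Set.Finite.pi' (t := fun _ : Fin d → Bool => Set.Icc (-d : ℤ) d)
    fun _ => Set.finite_Icc _ _).subset ?_
  rintro f ⟨hf, hf0⟩
  obtain ⟨z, hz⟩ : ∃ z, f z = 0 := by
    by_contra! h
    have : {v ∈ evenV d | f v ≠ 0} = (evens d : Set (Fin d → Bool)) := by
      ext v; simp [h, evens, evenV]
    rw [this, Set.ncard_coe_finset, card_evens hd] at hf0
    push_cast at hf0
    linarith
  intro v
  have h1 := abs_sub_le_card hf v z
  have h2 := Finset.card_filter_le (Finset.univ : Finset (Fin d)) (fun i => v i ≠ z i)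
  rw [Finset.card_univ, Fintype.card_fin] at h2
  rw [hz, sub_zero] at h1
  exact abs_le.1 (h1.trans (by exact_mod_cast h2))

/-- The nonempty subsets of `M` with at most `k` elements. -/
def smallSubsets {ι : Type*} [DecidableEq ι] (M : Finset ι) (k : ℕ) : Finset (Finset ι) :=
  (Finset.Icc 1 k).biUnion fun i => M.powersetCard i

theorem mem_smallSubsets {ι : Type*} [DecidableEq ι] {M A : Finset ι} {k : ℕ} :
    A ∈ smallSubsets M k ↔ A ⊆ M ∧ A.Nonempty ∧ A.card ≤ k := by
  simp only [smallSubsets, Finset.mem_biUnion, Finset.mem_Icc, Finset.mem_powersetCard,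
    ← Finset.card_pos]
  constructor
  · rintro ⟨i, hi, h, rfl⟩
    exact ⟨h, hi⟩
  · rintro ⟨h, hi⟩
    exact ⟨_, hi, h, rfl⟩

theorem sum_smallSubsets {ι : Type*} [DecidableEq ι] (M : Finset ι) (k : ℕ) (x : ℝ) :
    ∑ A ∈ smallSubsets M k, x ^ A.card = ∑ i ∈ Finset.Icc 1 k, (M.card.choose i : ℝ) * x ^ i := by
  rw [smallSubsets, Finset.sum_biUnion]
  · refine Finset.sum_congr rfl fun i _ => ?_
    rw [Finset.sum_congr rfl fun A hA => by rw [(Finset.mem_powersetCard.1 hA).2],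
      Finset.sum_const, Finset.card_powersetCard, nsmul_eq_mul]
  · exact (Finset.pairwise_disjoint_powersetCard M).set_pairwise _

theorem le_sum_smallSubsets {ι : Type*} [DecidableEq ι] (M : Finset ι) {k n t : ℕ} {x : ℝ}
    (hx : 0 ≤ x) (hn : 0 < n) (hM : n ≤ M.card + t) (hk : t + k ≤ n) :
    (1 - (k * (t + k) : ℝ) / n) * ∑ i ∈ Finset.Icc 1 k, (n * x) ^ i / (i.factorial : ℝ) ≤
      ∑ A ∈ smallSubsets M k, x ^ A.card := by
  rw [sum_smallSubsets, Finset.mul_sum]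
  refine Finset.sum_le_sum fun i hi => ?_
  obtain ⟨-, hik⟩ := Finset.mem_Icc.1 hi
  have hn' : (0 : ℝ) < n := by exact_mod_cast hn
  have hi' : (0 : ℝ) < i.factorial := by exact_mod_cast i.factorial_pos
  have hik' : (i : ℝ) ≤ k := by exact_mod_cast hik
  have hkn : (t + k : ℝ) ≤ n := by exact_mod_cast hk
  have hq : (t + k : ℝ) / n ≤ 1 := (div_le_one hn').2 hkn
  have hchoose : (n - (t + k) : ℝ) ^ i / i.factorial ≤ M.card.choose i := by
    have h1 := Nat.pow_sub_le_descFactorial M.card i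
    rw [Nat.descFactorial_eq_factorial_mul_choose] at h1
    have h2 : (n - (t + k)) ^ i ≤ i.factorial * M.card.choose i :=
      (Nat.pow_le_pow_left (by omega) i).trans h1
    have h3 : (((n - (t + k) : ℕ) : ℝ)) ^ i ≤ i.factorial * M.card.choose i := by
      exact_mod_cast h2
    rw [Nat.cast_sub hk, Nat.cast_add] at h3
    rw [div_le_iff₀ hi']
    linarith
  have hbern : 1 - (k * (t + k) : ℝ) / n ≤ (1 - (t + k : ℝ) / n) ^ i := by
    have h1 := one_add_mul_le_pow (a := -((t + k : ℝ) / n)) (by linarith) i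
    have h2 : (i : ℝ) * ((t + k) / n) ≤ k * ((t + k) / n) := by gcongr
    calc _ = 1 - k * ((t + k : ℝ) / n) := by ring
      _ ≤ 1 + i * -((t + k : ℝ) / n) := by linarith
      _ ≤ _ := by rwa [← sub_eq_add_neg] at h1
  calc _ ≤ (1 - (t + k : ℝ) / n) ^ i * ((n * x) ^ i / i.factorial) := by gcongr
    _ = (n - (t + k) : ℝ) ^ i / i.factorial * x ^ i := by
        rw [mul_div_assoc', ← mul_pow, div_mul_eq_mul_div, ← mul_pow]
        congr 2
        field_simp
    _ ≤ _ := by gcongr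

theorem sum_sum_card_Icc_le_ncard {α : ℝ} (hd : 1 ≤ d) (hα : (2 * d : ℝ) < α ^ d)
    (hα' : α ^ d < 2 ^ (d - 1)) :
    ∑ A ∈ smallSubsets (evens d) d, ∑ B ∈ smallSubsets (evens d \ nbhd (nbhd A)) d,
      (Finset.Icc (nbhd A) ((evens d)ᶜ \ nbhd B)).card ≤ (FEi d α 5).ncard := by
  let X := (smallSubsets (evens d) d).sigma fun A =>
    (smallSubsets (evens d \ nbhd (nbhd A)) d).sigma fun B =>
      Finset.Icc (nbhd A) ((evens d)ᶜ \ nbhd B)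
  have hX : ∀ p ∈ X, (p.1 ⊆ evens d ∧ p.1.Nonempty ∧ p.1.card ≤ d) ∧
      (p.2.1 ⊆ evens d ∧ p.2.1.Nonempty ∧ p.2.1.card ≤ d) ∧ Disjoint p.1 p.2.1 ∧
      p.2.2 ⊆ (evens d)ᶜ ∧ nbhd p.1 ⊆ p.2.2 ∧ Disjoint (nbhd p.2.1) p.2.2 := by
    rintro ⟨A, B, T⟩ hp
    simp only [X, Finset.mem_sigma, mem_smallSubsets, Finset.mem_Icc,
      Finset.subset_sdiff] at hp ⊢
    obtain ⟨hA, ⟨⟨hB, hAB⟩, hB'⟩, hAT, hT, hBT⟩ := hp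
    exact ⟨hA, ⟨hB, hB'⟩, (hAB.mono_right (subset_nbhd_nbhd hd A)).symm, hT, hAT, hBT.symm⟩
  have hcard : ∑ A ∈ smallSubsets (evens d) d,
      ∑ B ∈ smallSubsets (evens d \ nbhd (nbhd A)) d,
        (Finset.Icc (nbhd A) ((evens d)ᶜ \ nbhd B)).card = X.card := by
    simp only [X, Finset.card_sigma]
  rw [hcard, ← Set.ncard_coe_finset]
  refine Set.ncard_le_ncard_of_injOn (fun p => labelling p.1 p.2.1 p.2.2) ?_ ?_
    ((finite_FE hd hα').subset fun f hf => hf.1)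
  · intro p hp
    obtain ⟨⟨h1, h2, h3⟩, ⟨h4, h5, h6⟩, h7, h8, h9, h10⟩ := hX p hp
    exact labelling_mem_FEi hd hα hα' h1 h4 h2 h5 h3 h6 h7 h8 h9 h10
  · intro p hp q hq hpq
    obtain ⟨⟨h1, -⟩, ⟨h4, -⟩, h7, h8, -⟩ := hX p hp
    obtain ⟨⟨h1', -⟩, ⟨h4', -⟩, h7', h8', -⟩ := hX q hq
    have hv := fun v => congrFun hpq v
    obtain ⟨A, B, T⟩ := p
    obtain ⟨A', B', T'⟩ := q
    dsimp only at *
    obtain rfl : A = A' := Finset.ext fun v => by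
      rw [← labelling_eq_two (A := A) (B := B) (T := T), hv, labelling_eq_two]
    obtain rfl : B = B' := Finset.ext fun v => by
      rw [← labelling_eq_neg_two (T := T) h7, hv, labelling_eq_neg_two h7']
    obtain rfl : T = T' := Finset.ext fun v => by
      rw [← labelling_eq_one h1 h4 h8, hv, labelling_eq_one h1 h4 h8']
    rfl

theorem le_card_Icc (hd : 1 ≤ d) {A B : Finset (Fin d → Bool)} (hA : A ⊆ evens d)
    (hB : B ⊆ evens d \ nbhd (nbhd A)) :
    (2 : ℝ) ^ 2 ^ (d - 1) * (((1 / 2 : ℝ) ^ d) ^ A.card * ((1 / 2 : ℝ) ^ d) ^ B.card) ≤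
      (Finset.Icc (nbhd A) ((evens d)ᶜ \ nbhd B)).card := by
  rw [Finset.subset_sdiff] at hB
  rw [Finset.card_Icc_finset
    (Finset.subset_sdiff.2 ⟨nbhd_subset_compl_evens hA, disjoint_nbhd hB.2⟩),
    ← card_evens hd, ← pow_mul, ← pow_mul, ← pow_add, one_div, inv_pow, ← div_eq_mul_inv,
    div_le_iff₀ (by positivity), Nat.cast_pow, Nat.cast_ofNat, ← pow_add]
  refine pow_le_pow_right₀ (by norm_num) ?_
  have h1 := Finset.le_card_sdiff (nbhd B) (evens d)ᶜ
  have h2 := card_nbhd_le A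
  have h3 := card_nbhd_le B
  have h4 := card_evens_eq_card_compl hd
  omega

theorem mul_sq_le_ncard {α : ℝ} (hd : 1 ≤ d) (hα : (2 * d : ℝ) < α ^ d)
    (hα' : α ^ d < 2 ^ (d - 1)) (hbig : d * (d ^ 3 + d) ≤ 2 ^ (d - 1)) :
    (2 : ℝ) ^ 2 ^ (d - 1) * ((1 - (d * (d ^ 3 + d) : ℝ) / 2 ^ (d - 1)) *
      ∑ i ∈ Finset.Icc 1 d, (1 / 2 : ℝ) ^ i / (i.factorial : ℝ)) ^ 2 ≤ (FEi d α 5).ncard := by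
  set P := (1 - (d * (d ^ 3 + d) : ℝ) / 2 ^ (d - 1)) *
      ∑ i ∈ Finset.Icc 1 d, (1 / 2 : ℝ) ^ i / (i.factorial : ℝ) with hP
  have hx : (((2 ^ (d - 1) : ℕ) : ℝ) * (1 / 2) ^ d) = 1 / 2 := by
    obtain ⟨k, rfl⟩ := Nat.exists_eq_add_of_le' hd
    push_cast
    rw [pow_succ, ← mul_assoc, ← mul_pow]
    norm_num
  have hP0 : 0 ≤ P := by
    refine mul_nonneg (sub_nonneg.2 ((div_le_one (by positivity)).2 (by exact_mod_cast hbig)))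
      (Finset.sum_nonneg fun i _ => by positivity)
  have key : ∀ M : Finset (Fin d → Bool), 2 ^ (d - 1) ≤ M.card + d ^ 3 →
      P ≤ ∑ A ∈ smallSubsets M d, ((1 / 2 : ℝ) ^ d) ^ A.card := by
    intro M hM
    have := le_sum_smallSubsets M (k := d) (x := (1 / 2 : ℝ) ^ d) (by positivity) (by positivity)
      hM ((Nat.le_mul_of_pos_left _ hd).trans hbig)
    rw [hx] at this
    rw [hP]
    exact_mod_cast this
  calc _ = (2 : ℝ) ^ 2 ^ (d - 1) * (P * P) := by rw [sq]
    _ ≤ (2 : ℝ) ^ 2 ^ (d - 1) *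
        ∑ A ∈ smallSubsets (evens d) d, ((1 / 2 : ℝ) ^ d) ^ A.card * P := by
      rw [← Finset.sum_mul]
      gcongr
      exact key _ (by rw [card_evens hd]; omega)
    _ ≤ (2 : ℝ) ^ 2 ^ (d - 1) * ∑ A ∈ smallSubsets (evens d) d, ((1 / 2 : ℝ) ^ d) ^ A.card *
        ∑ B ∈ smallSubsets (evens d \ nbhd (nbhd A)) d, ((1 / 2 : ℝ) ^ d) ^ B.card := by
      gcongr with A hA
      refine key _ ?_
      have h1 := Finset.le_card_sdiff (nbhd (nbhd A)) (evens d)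
      have h2 : (nbhd (nbhd A)).card ≤ d ^ 3 := by
        calc _ ≤ d * (d * A.card) :=
              (card_nbhd_le _).trans (Nat.mul_le_mul_left _ (card_nbhd_le A))
          _ ≤ d * (d * d) := by gcongr; exact (mem_smallSubsets.1 hA).2.2
          _ = d ^ 3 := by ring
      rw [card_evens hd] at h1
      omega
    _ ≤ ((∑ A ∈ smallSubsets (evens d) d, ∑ B ∈ smallSubsets (evens d \ nbhd (nbhd A)) d,
          (Finset.Icc (nbhd A) ((evens d)ᶜ \ nbhd B)).card : ℕ) : ℝ) := by
      push_cast
      simp only [Finset.mul_sum]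
      refine Finset.sum_le_sum fun A hA => Finset.sum_le_sum fun B hB => ?_
      exact le_card_Icc hd (mem_smallSubsets.1 hA).1 (mem_smallSubsets.1 hB).1
    _ ≤ _ := by exact_mod_cast sum_sum_card_Icc_le_ncard hd hα hα'

theorem exp_half_sub_le (k : ℕ) :
    Real.exp (1 / 2) - 1 - (1 / 2) ^ k ≤
      ∑ i ∈ Finset.Icc 1 k, (1 / 2 : ℝ) ^ i / (i.factorial : ℝ) := by
  have h := Real.exp_bound' (x := 1 / 2) (by norm_num) (by norm_num) (Nat.succ_pos k)
  have hsum : ∑ m ∈ Finset.range (k + 1), (1 / 2 : ℝ) ^ m / (m.factorial : ℝ) =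
      1 + ∑ i ∈ Finset.Icc 1 k, (1 / 2 : ℝ) ^ i / (i.factorial : ℝ) := by
    rw [Finset.range_eq_Ico, Finset.sum_eq_sum_Ico_succ_bot (Nat.succ_pos k)]
    simp [Finset.Ico_add_one_right_eq_Icc]
  have htail : (1 / 2 : ℝ) ^ (k + 1) * ((k + 1 : ℕ) + 1) / ((k + 1).factorial * (k + 1 : ℕ)) ≤
      (1 / 2) ^ k := by
    have hf : (1 : ℝ) ≤ (k + 1).factorial := by exact_mod_cast (k + 1).factorial_pos
    have hk : (0 : ℝ) ≤ k := k.cast_nonneg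
    rw [div_le_iff₀ (by positivity), pow_succ, mul_assoc]
    refine mul_le_mul_of_nonneg_left ?_ (by positivity)
    push_cast
    nlinarith
  rw [Nat.succ_eq_add_one, hsum] at h
  linarith

theorem sq_sub_le_sq_mul {a S ε τ : ℝ} (ha0 : 0 ≤ a) (ha1 : a ≤ 1) (hε : 0 ≤ ε) (hε1 : ε ≤ 1)
    (hτ : 0 ≤ τ) (hS : a - τ ≤ S) : a ^ 2 - 2 * (τ + ε) ≤ ((1 - ε) * S) ^ 2 := by
  have h1 : a - (τ + ε) ≤ (1 - ε) * S := by
    have := mul_le_mul_of_nonneg_left hS (sub_nonneg.2 hε1)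
    nlinarith [mul_nonneg hε hτ]
  nlinarith [sq_nonneg ((1 - ε) * S - a)]

theorem eventually_bounds {α : ℝ} (hα1 : 1 < α) (hα2 : α < 2) :
    ∀ᶠ d : ℕ in Filter.atTop, 1 ≤ d ∧ (2 * d : ℝ) < α ^ d ∧ α ^ d < 2 ^ (d - 1) ∧
      10 * (d : ℝ) ^ 4 / 2 ^ d ≤ (2 / 3) ^ d := by
  have hα0 : 0 < α := by linarith
  have h1 := tendsto_pow_const_mul_const_pow_of_abs_lt_one 1 (r := 1 / α)
    (by rw [abs_of_pos (by positivity)]; exact (div_lt_one hα0).2 hα1)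
  have h2 := tendsto_pow_const_mul_const_pow_of_abs_lt_one 0 (r := α / 2)
    (by rw [abs_of_pos (by positivity)]; linarith)
  have h3 := tendsto_pow_const_mul_const_pow_of_abs_lt_one 4 (r := 3 / 4)
    (by rw [abs_of_pos (by positivity)]; norm_num)
  filter_upwards [Filter.eventually_ge_atTop 1,
    h1.eventually_lt_const (by norm_num : (0:ℝ) < 1 / 2),
    h2.eventually_lt_const (by norm_num : (0:ℝ) < 1 / 2),
    h3.eventually_lt_const (by norm_num : (0:ℝ) < 1 / 10)] with d hd h1 h2 h3
  refine ⟨hd, ?_, ?_, ?_⟩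
  · rw [pow_one, one_div, inv_pow, ← div_eq_mul_inv, div_lt_iff₀ (by positivity)] at h1
    linarith
  · rw [pow_zero, one_mul, div_pow, div_lt_iff₀ (by positivity)] at h2
    obtain ⟨k, rfl⟩ := Nat.exists_eq_add_of_le' hd
    rw [Nat.add_sub_cancel]
    rw [pow_succ 2] at h2
    linarith
  · rw [div_le_iff₀ (by positivity), ← mul_pow]
    have h4 : (3 / 4 : ℝ) ^ d * (2 / 3 * 2) ^ d = 1 := by
      rw [← mul_pow]; norm_num
    have h5 : (0 : ℝ) < (2 / 3 * 2) ^ d := by positivity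
    calc 10 * (d : ℝ) ^ 4 = 10 * ((d : ℝ) ^ 4 * (3 / 4) ^ d) * (2 / 3 * 2) ^ d := by
          rw [mul_assoc, mul_assoc, h4, mul_one]
      _ ≤ 1 * (2 / 3 * 2) ^ d := by gcongr; linarith
      _ = _ := one_mul _

end HammingCube

theorem lower_bound_FE5 (α : ℝ) (hα1 : 1 < α) (hα2 : α < 2) :
    ∃ c > (0:ℝ), ∃ d₀ : ℕ, ∀ d : ℕ, d₀ ≤ d →
      (Real.exp 1 - 2 * Real.sqrt (Real.exp 1) + 1 - Real.exp (-c * d)) * 2 ^ 2 ^ (d - 1) ≤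
        ((FEi d α 5).ncard : ℝ) := by
  obtain ⟨d₀, hd₀⟩ := Filter.eventually_atTop.1 (HammingCube.eventually_bounds hα1 hα2)
  refine ⟨Real.log (3 / 2), Real.log_pos (by norm_num), d₀, fun d hd => ?_⟩
  obtain ⟨hd1, hα, hα', hbound⟩ := hd₀ d hd
  have hexp : Real.exp (-Real.log (3 / 2) * d) = (2 / 3) ^ d := by
    rw [mul_comm, Real.exp_nat_mul, Real.exp_neg, Real.exp_log (by norm_num)]
    norm_num
  have hd' : (1 : ℝ) ≤ d := by exact_mod_cast hd1
  have hpow : (2 : ℝ) ^ d = 2 ^ (d - 1) * 2 := by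
    rw [← pow_succ, Nat.sub_add_cancel hd1]
  have hd4 : (d * (d ^ 3 + d) : ℝ) ≤ 2 * d ^ 4 := by
    nlinarith [pow_le_pow_right₀ hd' (by norm_num : 2 ≤ 4)]
  have hε : (d * (d ^ 3 + d) : ℝ) / 2 ^ (d - 1) ≤ 4 * d ^ 4 / 2 ^ d := by
    rw [hpow, div_le_div_iff₀ (by positivity) (by positivity)]
    nlinarith [pow_pos (two_pos : (0 : ℝ) < 2) (d - 1)]
  have hτ : (1 / 2 : ℝ) ^ d ≤ d ^ 4 / 2 ^ d := by
    rw [div_pow, one_pow]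
    gcongr
    exact one_le_pow₀ hd'
  have hsum : 2 * ((1 / 2 : ℝ) ^ d + (d * (d ^ 3 + d) : ℝ) / 2 ^ (d - 1)) ≤ (2 / 3) ^ d := by
    calc _ ≤ 2 * ((d : ℝ) ^ 4 / 2 ^ d + 4 * d ^ 4 / 2 ^ d) := by gcongr
      _ = 10 * (d : ℝ) ^ 4 / 2 ^ d := by ring
      _ ≤ _ := hbound
  have hε1 : (d * (d ^ 3 + d) : ℝ) / 2 ^ (d - 1) ≤ 1 := by
    have h1 : (2 / 3 : ℝ) ^ d ≤ 1 := pow_le_one₀ (by norm_num) (by norm_num)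
    have h2 : (0 : ℝ) < (1 / 2) ^ d := by positivity
    have h3 : (0 : ℝ) ≤ (d * (d ^ 3 + d) : ℝ) / 2 ^ (d - 1) := by positivity
    linarith
  have hbig : d * (d ^ 3 + d) ≤ 2 ^ (d - 1) := by
    rw [div_le_one (by positivity)] at hε1
    exact_mod_cast hε1
  have hsqrt : Real.sqrt (Real.exp 1) = Real.exp (1 / 2) := (Real.exp_half 1).symm
  have hsq : Real.exp (1 / 2) ^ 2 = Real.exp 1 := by
    rw [← hsqrt, Real.sq_sqrt (Real.exp_pos 1).le]
  have ha0 : 0 ≤ Real.exp (1 / 2) - 1 := by linarith [Real.add_one_le_exp (1 / 2 : ℝ)]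
  have ha1 : Real.exp (1 / 2) - 1 ≤ 1 := by
    nlinarith [Real.exp_one_lt_d9]
  have hmain := HammingCube.sq_sub_le_sq_mul ha0 ha1 (by positivity) hε1 (by positivity)
    (HammingCube.exp_half_sub_le d)
  refine le_trans ?_ (HammingCube.mul_sq_le_ncard hd1 hα hα' hbig)
  rw [mul_comm, hexp, hsqrt]
  refine mul_le_mul_of_nonneg_left ?_ (by positivity)
  nlinarith
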